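/- There is an absolute constant c > 0 such that the following holds. For every n ∈ ℕ, every ε ∈ (0,1], and every symmetric convex set K ⊆ ℝⁿ with 0 < vol(K) ≤ 1 − ε, one has E_{x ∼ N(0,I_n)|K}[‖x‖²] ≤ n − c·ε. -/

import Mathlib

open MeasureTheory ProbabilityTheory Real

/-- The standard Gaussian measure `N(0, I_n)` on `ℝⁿ`. -/
noncomputable def stdGaussian (n : ℕ) : Measure (EuclideanSpace ℝ (Fin n)) :=
  volume.withDensity fun x =>
    ENNReal.ofReal ((2 * π) ^ (-(n : ℝ) / 2) * Real.exp (-‖x‖ ^ 2 / 2))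

/-- The standard Gaussian measure conditioned on the set `K`. -/
noncomputable def truncGaussian (n : ℕ) (K : Set (EuclideanSpace ℝ (Fin n))) :
    Measure (EuclideanSpace ℝ (Fin n)) :=
  (stdGaussian n K)⁻¹ • (stdGaussian n).restrict K

/-- density of the standard Gaussian -/
noncomputable def gdens (n : ℕ) (x : EuclideanSpace ℝ (Fin n)) : ℝ :=
  (2 * π) ^ (-(n : ℝ) / 2) * Real.exp (-‖x‖ ^ 2 / 2)

lemma gdens_pos (n : ℕ) (x : EuclideanSpace ℝ (Fin n)) : 0 < gdens n x := by
  unfold gdens; positivity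

lemma gdens_cont (n : ℕ) : Continuous (gdens n) := by
  unfold gdens; fun_prop

lemma stdG_def (n : ℕ) : _root_.stdGaussian n
    = volume.withDensity fun x => ENNReal.ofReal (gdens n x) := rfl

lemma gdens_integrable (n : ℕ) : Integrable (gdens n) := by
  have h := (GaussianFourier.integrable_cexp_neg_mul_sq_norm_add (b := (1/2 : ℂ)) (by norm_num) 0
    (0 : EuclideanSpace ℝ (Fin n))).norm.const_mul ((2 * π) ^ (-(n : ℝ) / 2))
  refine h.congr (Filter.Eventually.of_forall fun x => ?_)
  simp only [gdens, Complex.norm_exp]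
  congr 2
  rw [show (-(1 / 2 : ℂ) * (‖x‖ : ℂ) ^ 2 + 0 * ((inner ℝ (0 : EuclideanSpace ℝ (Fin n)) x : ℝ) : ℂ))
    = ((-‖x‖ ^ 2 / 2 : ℝ) : ℂ) by push_cast; ring, Complex.ofReal_re]

lemma stdG_finite (n : ℕ) : IsFiniteMeasure (_root_.stdGaussian n) := by
  rw [stdG_def]
  exact isFiniteMeasure_withDensity_ofReal (gdens_integrable n).2

lemma stdG_eq (n : ℕ) : _root_.stdGaussian n
    = ProbabilityTheory.stdGaussian (EuclideanSpace ℝ (Fin n)) := by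
  have := stdG_finite n
  apply Measure.ext_of_charFun
  ext t
  rw [charFun_stdGaussian, charFun_apply, stdG_def]
  have hm : Measurable (fun x => (gdens n x).toNNReal) := (gdens_cont n).measurable.real_toNNReal
  have := integral_withDensity_eq_integral_smul (μ := volume) hm
    (fun x : EuclideanSpace ℝ (Fin n) => Complex.exp ((inner ℝ x t : ℝ) * Complex.I))
  rw [show (fun x => ENNReal.ofReal (gdens n x)) = fun x => ((gdens n x).toNNReal : ENNReal) from rfl,
    this]
  have h := GaussianFourier.integral_cexp_neg_mul_sq_norm_add (b := (1/2 : ℂ)) (by norm_num)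
    Complex.I t
  have h2 : ∀ x : EuclideanSpace ℝ (Fin n), (gdens n x).toNNReal •
      Complex.exp ((inner ℝ x t : ℝ) * Complex.I)
      = (((2 * π) ^ (-(n : ℝ) / 2) : ℝ) : ℂ) *
        Complex.exp (-(1/2) * ‖x‖ ^ 2 + Complex.I * (inner ℝ t x : ℝ)) := by
    intro x
    rw [NNReal.smul_def, Real.coe_toNNReal _ (gdens_pos n x).le, Complex.real_smul, gdens,
      Complex.ofReal_mul, mul_assoc, Complex.ofReal_exp, ← Complex.exp_add, real_inner_comm]
    congr 2
    push_cast
    ring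
  simp_rw [h2]
  rw [integral_const_mul, h, ← mul_assoc]
  have h3 : (((2 * π) ^ (-(n : ℝ) / 2) : ℝ) : ℂ) * ((π : ℂ) / (1/2)) ^
      ((Module.finrank ℝ (EuclideanSpace ℝ (Fin n)) : ℂ) / 2) = 1 := by
    rw [finrank_euclideanSpace_fin]
    have : ((π : ℂ) / (1/2)) ^ ((n : ℂ) / 2) = (((2 * π) ^ ((n : ℝ) / 2) : ℝ) : ℂ) := by
      rw [Complex.ofReal_cpow (by positivity)]
      push_cast
      congr 1
      ring
    rw [this, ← Complex.ofReal_mul, ← Real.rpow_add (by positivity)]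
    simp [neg_div]
  rw [h3, one_mul]
  congr 1
  rw [Complex.I_sq]
  ring

instance stdG_prob (n : ℕ) : IsProbabilityMeasure (_root_.stdGaussian n) := by
  rw [stdG_eq]; infer_instance

instance stdG_gauss (n : ℕ) : IsGaussian (_root_.stdGaussian n) := by
  rw [stdG_eq]; infer_instance

lemma stdG_rotation (n : ℕ) (θ : ℝ) :
    ((_root_.stdGaussian n).prod (_root_.stdGaussian n)).map (ContinuousLinearMap.rotation θ)
      = (_root_.stdGaussian n).prod (_root_.stdGaussian n) := by
  apply IsGaussian.map_rotation_eq_self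
  rw [stdG_eq]
  exact integral_id_stdGaussian

/-- dimension-free first moment bound. -/
lemma stdG_abs_le (n : ℕ) (L : EuclideanSpace ℝ (Fin n) →L[ℝ] ℝ) :
    ∫ y, |L y| ∂(_root_.stdGaussian n) ≤ ‖L‖ := by
  have hm : MemLp L 2 (_root_.stdGaussian n) := by
    exact L.comp_memLp' (IsGaussian.memLp_two_id)
  have h0 : ∫ y, L y ∂(_root_.stdGaussian n) = 0 := by
    rw [stdG_eq]; exact integral_strongDual_stdGaussian L
  have h1 : ∫ y, (L y) ^ 2 ∂(_root_.stdGaussian n) = ‖L‖ ^ 2 := by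
    have := variance_dual_stdGaussian L
    rw [← stdG_eq, variance_of_integral_eq_zero hm.aestronglyMeasurable.aemeasurable h0] at this
    exact this
  have hi : Integrable (fun y => |L y|) (_root_.stdGaussian n) := (hm.integrable (by norm_num)).abs
  have h2 : (∫ y, |L y| ∂(_root_.stdGaussian n)) ^ 2 ≤ ‖L‖ ^ 2 := by
    have hv := variance_nonneg |⇑L| (_root_.stdGaussian n)
    rw [variance_eq_sub hm.abs] at hv
    have h3 : ∫ y, (|⇑L| ^ 2) y ∂(_root_.stdGaussian n) = ‖L‖ ^ 2 := by
      rw [← h1]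
      congr 1
      ext y
      simp
    have h4 : ∫ y, |⇑L| y ∂(_root_.stdGaussian n) = ∫ y, |L y| ∂(_root_.stdGaussian n) := rfl
    rw [h3, h4] at hv
    linarith
  exact le_of_sq_le_sq h2 (norm_nonneg _)
open scoped ENNReal in
/-- One-dimensional Brunn-Minkowski (midpoint form), compact sets. -/
lemma bm_compact (A B C : Set ℝ) (hA : IsCompact A) (hB : IsCompact B) (hA0 : A.Nonempty)
    (hB0 : B.Nonempty) (hC : ∀ x ∈ A, ∀ y ∈ B, (x + y) / 2 ∈ C) :
    volume A + volume B ≤ 2 * volume C := by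
  have ha : sSup A ∈ A := hA.sSup_mem hA0
  have hb : sInf B ∈ B := hB.sInf_mem hB0
  set a := sSup A
  set b := sInf B
  let D : Set ℝ := (fun x => (2 : ℝ)⁻¹ * x) ⁻¹' C
  have hD : volume D = 2 * volume C := by
    rw [Real.volume_preimage_mul_left (by norm_num)]
    norm_num
  rw [← hD]
  have h1 : (fun x => x + (-b)) ⁻¹' A ⊆ D := by
    intro x hx
    have := hC _ hx _ hb
    simp only [D, Set.mem_preimage]
    convert this using 1; ring
  have h2 : (fun x => x + (-a)) ⁻¹' B ⊆ D := by
    intro x hx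
    have := hC _ ha _ hx
    simp only [D, Set.mem_preimage]
    convert this using 1; ring
  have h3 : volume ((fun x => x + (-b)) ⁻¹' A) = volume A := measure_preimage_add_right _ _ _
  have h4 : volume ((fun x => x + (-a)) ⁻¹' B) = volume B := measure_preimage_add_right _ _ _
  rw [← h3, ← h4]
  have hd : AEDisjoint volume ((fun x => x + (-b)) ⁻¹' A) ((fun x => x + (-a)) ⁻¹' B) := by
    refine measure_mono_null (t := {a + b}) ?_ (by simp)
    rintro x ⟨hx, hy⟩
    have e1 : x + -b ≤ a := le_csSup hA.bddAbove hx
    have e2 : b ≤ x + -a := csInf_le hB.bddBelow hy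
    simp only [Set.mem_singleton_iff]; linarith
  have hBm : MeasurableSet ((fun x => x + (-a)) ⁻¹' B) :=
    (by fun_prop : Measurable fun x : ℝ => x + (-a)) hB.measurableSet
  rw [← measure_union₀ hBm.nullMeasurableSet hd]
  exact measure_mono (Set.union_subset h1 h2)

open scoped ENNReal in
lemma bm_meas (A B C : Set ℝ) (hA : MeasurableSet A) (hB : MeasurableSet B) (hA0 : A.Nonempty)
    (hB0 : B.Nonempty) (hC : ∀ x ∈ A, ∀ y ∈ B, (x + y) / 2 ∈ C) :
    volume A + volume B ≤ 2 * volume C := by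
  obtain ⟨a0, ha0⟩ := hA0
  obtain ⟨b0, hb0⟩ := hB0
  rw [hA.measure_eq_iSup_isCompact, hB.measure_eq_iSup_isCompact]
  have key : ∀ K1 : Set ℝ, K1 ⊆ A → IsCompact K1 → ∀ K2 : Set ℝ, K2 ⊆ B → IsCompact K2 →
      volume K1 + volume K2 ≤ 2 * volume C := by
    intro K1 h1 c1 K2 h2 c2
    refine le_trans (add_le_add (measure_mono (Set.subset_insert a0 K1))
      (measure_mono (Set.subset_insert b0 K2))) ?_
    refine bm_compact _ _ _ (c1.insert a0) (c2.insert b0) (Set.insert_nonempty _ _)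
      (Set.insert_nonempty _ _) ?_
    intro x hx y hy
    apply hC
    · rcases hx with rfl | hx
      exacts [ha0, h1 hx]
    · rcases hy with rfl | hy
      exacts [hb0, h2 hy]
  simp_rw [iSup_and']
  refine ENNReal.biSup_add_biSup_le' ⟨∅, Set.empty_subset _, isCompact_empty⟩
    ⟨∅, Set.empty_subset _, isCompact_empty⟩ ?_
  rintro K1 ⟨h1, c1⟩ K2 ⟨h2, c2⟩
  exact key K1 h1 c1 K2 h2 c2

open scoped ENNReal in
lemma pl_norm (f g h : ℝ → ℝ) (hf : Measurable f) (hg : Measurable g) (hh : Measurable h)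
    (f0 : ∀ x, 0 ≤ f x) (g0 : ∀ x, 0 ≤ g x) (h0 : ∀ x, 0 ≤ h x)
    (f1 : ∀ x, f x ≤ 1) (g1 : ∀ x, g x ≤ 1) (fs : ∀ t < 1, ∃ x, t < f x)
    (gs : ∀ t < 1, ∃ x, t < g x) (H : ∀ x y, f x * g y ≤ h ((x + y) / 2) ^ 2) :
    (∫⁻ x, ENNReal.ofReal (f x)) + (∫⁻ x, ENNReal.ofReal (g x))
      ≤ 2 * ∫⁻ x, ENNReal.ofReal (h x) := by
  rw [lintegral_eq_lintegral_meas_lt _ (Filter.Eventually.of_forall f0) hf.aemeasurable,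
    lintegral_eq_lintegral_meas_lt _ (Filter.Eventually.of_forall g0) hg.aemeasurable,
    lintegral_eq_lintegral_meas_lt _ (Filter.Eventually.of_forall h0) hh.aemeasurable]
  have anti : ∀ u : ℝ → ℝ, Measurable fun t => volume {a : ℝ | t < u a} := by
    intro u
    refine Antitone.measurable ?_
    intro s t hst
    exact measure_mono fun a ha => lt_of_le_of_lt hst ha
  rw [← lintegral_add_left (anti f), ← lintegral_const_mul _ (anti h)]
  refine setLIntegral_mono' measurableSet_Ioi ?_
  intro t ht
  rw [Set.mem_Ioi] at ht
  rcases lt_or_ge t 1 with h1 | h1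
  · refine bm_meas _ _ _ (measurableSet_lt measurable_const hf)
      (measurableSet_lt measurable_const hg) (fs t h1) (gs t h1) ?_
    intro x hx y hy
    simp only [Set.mem_ofPred_eq] at *
    have : t ^ 2 < h ((x + y) / 2) ^ 2 := by
      refine lt_of_lt_of_le ?_ (H x y)
      nlinarith
    exact lt_of_pow_lt_pow_left₀ 2 (h0 _) this
  · have e1 : {a : ℝ | t < f a} = ∅ := by
      ext a; simp only [Set.mem_ofPred_eq, Set.mem_empty_iff_false, iff_false, not_lt]
      exact (f1 a).trans h1
    have e2 : {a : ℝ | t < g a} = ∅ := by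
      ext a; simp only [Set.mem_ofPred_eq, Set.mem_empty_iff_false, iff_false, not_lt]
      exact (g1 a).trans h1
    rw [e1, e2]; simp

open scoped ENNReal in
lemma ennreal_amgm (x y : ℝ≥0∞) : 4 * (x * y) ≤ (x + y) ^ 2 := by
  rcases eq_or_ne x ⊤ with rfl | hx
  · simp
  rcases eq_or_ne y ⊤ with rfl | hy
  · simp
  lift x to NNReal using hx
  lift y to NNReal using hy
  norm_cast
  rw [← NNReal.coe_le_coe]
  push_cast
  nlinarith [sq_nonneg ((x : ℝ) - y)]

open scoped ENNReal in
lemma pl_bdd (f g h : ℝ → ℝ) (hf : Measurable f) (hg : Measurable g) (hh : Measurable h)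
    (f0 : ∀ x, 0 ≤ f x) (g0 : ∀ x, 0 ≤ g x) (h0 : ∀ x, 0 ≤ h x)
    (f1 : BddAbove (Set.range f)) (g1 : BddAbove (Set.range g))
    (H : ∀ x y, f x * g y ≤ h ((x + y) / 2) ^ 2) :
    (∫⁻ x, ENNReal.ofReal (f x)) * (∫⁻ x, ENNReal.ofReal (g x))
      ≤ (∫⁻ x, ENNReal.ofReal (h x)) ^ 2 := by
  by_cases hfz : ∀ x, f x = 0
  · simp [hfz]
  by_cases hgz : ∀ x, g x = 0
  · simp [hgz]
  push Not at hfz hgz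
  obtain ⟨x0, hx0⟩ := hfz
  obtain ⟨y0, hy0⟩ := hgz
  have ha : 0 < sSup (Set.range f) :=
    lt_of_lt_of_le (lt_of_le_of_ne (f0 x0) hx0.symm) (le_csSup f1 ⟨x0, rfl⟩)
  have hb : 0 < sSup (Set.range g) :=
    lt_of_lt_of_le (lt_of_le_of_ne (g0 y0) hy0.symm) (le_csSup g1 ⟨y0, rfl⟩)
  have hfa : ∀ x, f x ≤ sSup (Set.range f) := fun x => le_csSup f1 ⟨x, rfl⟩
  have hgb : ∀ x, g x ≤ sSup (Set.range g) := fun x => le_csSup g1 ⟨x, rfl⟩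
  have hfs : ∀ t < sSup (Set.range f), ∃ x, t < f x := by
    intro t ht
    obtain ⟨_, ⟨x, rfl⟩, hx⟩ := exists_lt_of_lt_csSup (Set.range_nonempty f) ht
    exact ⟨x, hx⟩
  have hgs : ∀ t < sSup (Set.range g), ∃ x, t < g x := by
    intro t ht
    obtain ⟨_, ⟨x, rfl⟩, hx⟩ := exists_lt_of_lt_csSup (Set.range_nonempty g) ht
    exact ⟨x, hx⟩
  generalize sSup (Set.range f) = a at *
  generalize sSup (Set.range g) = b at *
  have hs : 0 < √(a * b) := by positivity
  have hss : √(a * b) ^ 2 = a * b := Real.sq_sqrt (by positivity)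
  set s := √(a * b)
  have key := pl_norm (fun x => a⁻¹ * f x) (fun x => b⁻¹ * g x) (fun x => s⁻¹ * h x)
    (hf.const_mul _) (hg.const_mul _) (hh.const_mul _)
    (fun x => mul_nonneg (by positivity) (f0 x)) (fun x => mul_nonneg (by positivity) (g0 x))
    (fun x => mul_nonneg (by positivity) (h0 x))
    (fun x => by rw [inv_mul_le_iff₀ ha]; simpa using hfa x)
    (fun x => by rw [inv_mul_le_iff₀ hb]; simpa using hgb x)
    (fun t ht => by
      obtain ⟨x, hx⟩ := hfs (a * t) (by nlinarith)
      exact ⟨x, by rwa [lt_inv_mul_iff₀ ha]⟩)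
    (fun t ht => by
      obtain ⟨x, hx⟩ := hgs (b * t) (by nlinarith)
      exact ⟨x, by rwa [lt_inv_mul_iff₀ hb]⟩)
    (fun x y => by
      rw [mul_pow, inv_pow, hss, mul_inv]
      have := mul_le_mul_of_nonneg_left (H x y) (show 0 ≤ a⁻¹ * b⁻¹ by positivity)
      linarith)
  have pull : ∀ (c : ℝ) (u : ℝ → ℝ), 0 < c → Measurable u →
      ∫⁻ x, ENNReal.ofReal (c * u x) = ENNReal.ofReal c * ∫⁻ x, ENNReal.ofReal (u x) := by
    intro c u hc hu
    rw [← lintegral_const_mul _ hu.ennreal_ofReal]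
    congr 1; ext x
    rw [ENNReal.ofReal_mul hc.le]
  rw [pull _ f (by positivity) hf, pull _ g (by positivity) hg, pull _ h (by positivity) hh] at key
  have hαβ : ENNReal.ofReal a⁻¹ * ENNReal.ofReal b⁻¹ = ENNReal.ofReal s⁻¹ ^ 2 := by
    rw [← ENNReal.ofReal_mul (by positivity), ← ENNReal.ofReal_pow (by positivity), inv_pow, hss,
      mul_inv]
  have h1 := (ennreal_amgm _ _).trans (pow_le_pow_left' key 2)
  set F := ∫⁻ x, ENNReal.ofReal (f x)
  set G := ∫⁻ x, ENNReal.ofReal (g x)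
  set I := ∫⁻ x, ENNReal.ofReal (h x)
  have h2 : 4 * (ENNReal.ofReal a⁻¹ * F * (ENNReal.ofReal b⁻¹ * G))
      = (4 * ENNReal.ofReal s⁻¹ ^ 2) * (F * G) := by rw [← hαβ]; ring
  have h3 : (2 * (ENNReal.ofReal s⁻¹ * I)) ^ 2 = (4 * ENNReal.ofReal s⁻¹ ^ 2) * I ^ 2 := by ring
  rw [h2, h3] at h1
  have hσ : ENNReal.ofReal s⁻¹ ≠ 0 := by simpa using hs
  exact (ENNReal.mul_le_mul_iff_right (by simp [hσ]) (by finiteness)).1 h1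

open scoped ENNReal in
lemma pl_one (f g h : ℝ → ℝ≥0∞) (hf : Measurable f) (hg : Measurable g) (hh : Measurable h)
    (H : ∀ x y, f x * g y ≤ h ((x + y) / 2) ^ 2) :
    (∫⁻ x, f x) * (∫⁻ x, g x) ≤ (∫⁻ x, h x) ^ 2 := by
  have trunc : ∀ u : ℝ → ℝ≥0∞, Measurable u →
      ∫⁻ x, u x = ⨆ N : ℕ, ∫⁻ x, min (u x) (N : ℝ≥0∞) := by
    intro u hu
    rw [← lintegral_iSup (fun N => hu.min measurable_const)]
    · congr 1; ext x
      rw [← inf_iSup_eq, ENNReal.iSup_natCast, inf_top_eq]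
    · intro N M hNM x
      exact min_le_min le_rfl (by exact_mod_cast hNM)
  rw [trunc f hf, trunc g hg]
  simp only [ENNReal.iSup_mul, ENNReal.mul_iSup, iSup_le_iff]
  intro M N
  have fin : ∀ (z : ℝ≥0∞) (n : ℕ), min z n ≠ ⊤ :=
    fun z n => ne_top_of_le_ne_top (ENNReal.natCast_ne_top n) (min_le_right _ _)
  have bnd : ∀ (z : ℝ≥0∞) (n : ℕ), (min z n).toReal ≤ n := by
    intro z n
    have := ENNReal.toReal_mono (ENNReal.natCast_ne_top n) (min_le_right z (n : ℝ≥0∞))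
    simpa using this
  have key := pl_bdd (fun x => (min (f x) (N : ℝ≥0∞)).toReal)
    (fun x => (min (g x) (M : ℝ≥0∞)).toReal)
    (fun x => (min (h x) ((max N M : ℕ) : ℝ≥0∞)).toReal)
    (hf.min measurable_const).ennreal_toReal (hg.min measurable_const).ennreal_toReal
    (hh.min measurable_const).ennreal_toReal
    (fun _ => ENNReal.toReal_nonneg) (fun _ => ENNReal.toReal_nonneg)
    (fun _ => ENNReal.toReal_nonneg)
    ⟨N, by rintro _ ⟨x, rfl⟩; exact bnd _ _⟩ ⟨M, by rintro _ ⟨x, rfl⟩; exact bnd _ _⟩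
    (fun x y => by
      rw [← ENNReal.toReal_mul, ← ENNReal.toReal_pow]
      refine ENNReal.toReal_mono (ENNReal.pow_ne_top (fin _ _)) ?_
      rcases le_total (h ((x + y) / 2)) ((max N M : ℕ) : ℝ≥0∞) with hc | hc
      · rw [min_eq_left hc]
        exact (mul_le_mul' (min_le_left _ _) (min_le_left _ _)).trans (H x y)
      · rw [min_eq_right hc, sq]
        refine mul_le_mul' ((min_le_right _ _).trans ?_) ((min_le_right _ _).trans ?_)
        · exact_mod_cast le_max_left N M
        · exact_mod_cast le_max_right N M)
  simp only [ENNReal.ofReal_toReal (fin _ _)] at key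
  refine key.trans ?_
  gcongr
  exact min_le_left _ _

open scoped ENNReal in
/-- Prekopa-Leindler inequality (midpoint form). -/
lemma pl_pi (n : ℕ) : ∀ (f g h : (Fin n → ℝ) → ℝ≥0∞), Measurable f → Measurable g → Measurable h →
    (∀ x y, f x * g y ≤ h ((1 / 2 : ℝ) • (x + y)) ^ 2) →
    (∫⁻ x, f x) * (∫⁻ x, g x) ≤ (∫⁻ x, h x) ^ 2 := by
  induction n with
  | zero =>
    intro f g h _ _ _ H
    have hv : (volume : Measure (Fin 0 → ℝ)) = Measure.dirac 0 := MeasureTheory.Measure.volume_pi_eq_dirac 0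
    rw [hv, lintegral_dirac, lintegral_dirac, lintegral_dirac]
    simpa using H 0 0
  | succ n ih =>
    intro f g h hf hg hh H
    let e := MeasurableEquiv.piFinSuccAbove (fun _ : Fin (n + 1) => ℝ) 0
    have hmp := (volume_preserving_piFinSuccAbove (fun _ : Fin (n + 1) => ℝ) 0).symm
    have split : ∀ u : (Fin (n + 1) → ℝ) → ℝ≥0∞, Measurable u →
        ∫⁻ x, u x = ∫⁻ s : ℝ, ∫⁻ x : Fin n → ℝ, u (e.symm (s, x)) := by
      intro u hu
      rw [← hmp.lintegral_comp hu, Measure.volume_eq_prod,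
        lintegral_prod (fun z => u (e.symm z)) (hu.comp e.symm.measurable).aemeasurable]
    rw [split f hf, split g hg, split h hh]
    have meas : ∀ u : (Fin (n + 1) → ℝ) → ℝ≥0∞, Measurable u →
        Measurable fun s : ℝ => ∫⁻ x : Fin n → ℝ, u (e.symm (s, x)) := fun u hu =>
      (hu.comp e.symm.measurable).lintegral_prod_right'
    refine pl_one _ _ _ (meas f hf) (meas g hg) (meas h hh) ?_
    intro s t
    refine ih _ _ _ (by fun_prop) (by fun_prop) (by fun_prop) ?_
    intro x y
    convert H (e.symm (s, x)) (e.symm (t, y)) using 3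
    ext i
    refine Fin.cases ?_ (fun j => ?_) i
    · simp [e, MeasurableEquiv.piFinSuccAbove, Fin.insertNthEquiv]; ring
    · simp [e, MeasurableEquiv.piFinSuccAbove, Fin.insertNthEquiv]; ring
lemma one_add_sq_le_cosh (y : ℝ) : 1 + y ^ 2 / 2 ≤ Real.cosh y := by
  rw [← Real.cosh_abs, ← sq_abs]
  have h0 : 0 ≤ |y| := abs_nonneg y
  generalize |y| = z at *
  have h1 : z / 2 ≤ Real.sinh (z / 2) := Real.self_le_sinh_iff.2 (by linarith)
  have h2 := Real.cosh_two_mul (z / 2)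
  rw [Real.cosh_sq, show 2 * (z / 2) = z by ring] at h2
  nlinarith

open scoped ENNReal in
lemma pl_euc (n : ℕ) (f g h : EuclideanSpace ℝ (Fin n) → ℝ≥0∞) (hf : Measurable f)
    (hg : Measurable g) (hh : Measurable h)
    (H : ∀ x y, f x * g y ≤ h ((1 / 2 : ℝ) • (x + y)) ^ 2) :
    (∫⁻ x, f x) * (∫⁻ x, g x) ≤ (∫⁻ x, h x) ^ 2 := by
  have hp := PiLp.volume_preserving_toLp (Fin n)
  have hm : Measurable (@WithLp.toLp 2 (Fin n → ℝ)) := hp.measurable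
  rw [← hp.lintegral_comp hf, ← hp.lintegral_comp hg, ← hp.lintegral_comp hh]
  exact pl_pi n _ _ _ (hf.comp hm) (hg.comp hm) (hh.comp hm) fun x y => H _ _

lemma gdens_shift (n : ℕ) (x z : EuclideanSpace ℝ (Fin n)) :
    gdens n (x + z) = gdens n x * Real.exp (-inner ℝ x z - ‖z‖ ^ 2 / 2) := by
  unfold gdens
  rw [mul_assoc, ← Real.exp_add, norm_add_sq_real]
  congr 2; ring

lemma gdens_mid (n : ℕ) (a b : EuclideanSpace ℝ (Fin n)) :
    gdens n a * gdens n b ≤ gdens n ((1 / 2 : ℝ) • (a + b)) ^ 2 := by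
  unfold gdens
  have h1 : ‖a + b‖ ^ 2 ≤ 2 * ‖a‖ ^ 2 + 2 * ‖b‖ ^ 2 := by
    have := parallelogram_law_with_norm ℝ a b
    nlinarith [norm_nonneg (a - b)]
  have h2 : Real.exp (-‖a‖ ^ 2 / 2) * Real.exp (-‖b‖ ^ 2 / 2)
      ≤ Real.exp (-‖(1 / 2 : ℝ) • (a + b)‖ ^ 2 / 2) ^ 2 := by
    rw [← Real.exp_add, ← Real.exp_nat_mul, norm_smul]
    apply Real.exp_le_exp.2
    rw [mul_pow]
    norm_num
    linarith
  have h3 : 0 ≤ ((2 * π) ^ (-(n : ℝ) / 2)) ^ 2 := by positivity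
  nlinarith [mul_le_mul_of_nonneg_left h2 h3]

/-- Anderson's inequality for the Gaussian density. -/
lemma anderson (n : ℕ) (K : Set (EuclideanSpace ℝ (Fin n))) (hc : Convex ℝ K)
    (hs : ∀ x ∈ K, -x ∈ K) (hm : MeasurableSet K) (z : EuclideanSpace ℝ (Fin n)) :
    ∫⁻ x in K, ENNReal.ofReal (Real.exp (-inner ℝ x z - ‖z‖ ^ 2 / 2)) ∂(_root_.stdGaussian n)
      ≤ _root_.stdGaussian n K := by
  have hgm : Measurable fun x => ENNReal.ofReal (gdens n x) :=
    (gdens_cont n).measurable.ennreal_ofReal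
  have conv : ∀ z : EuclideanSpace ℝ (Fin n),
      ∫⁻ x in K, ENNReal.ofReal (Real.exp (-inner ℝ x z - ‖z‖ ^ 2 / 2)) ∂(_root_.stdGaussian n)
      = ∫⁻ x, K.indicator (fun x => ENNReal.ofReal (gdens n (x + z))) x := by
    intro z
    rw [stdG_def, setLIntegral_withDensity_eq_setLIntegral_mul _ hgm (by fun_prop) hm,
      lintegral_indicator hm]
    congr 1; ext x
    simp only [Pi.mul_apply]
    rw [← ENNReal.ofReal_mul (gdens_pos n x).le, gdens_shift]
  have hK : _root_.stdGaussian n K = ∫⁻ x, K.indicator (fun x => ENNReal.ofReal (gdens n x)) x := by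
    rw [stdG_def, withDensity_apply _ hm, lintegral_indicator hm]
  have hmz : ∀ z : EuclideanSpace ℝ (Fin n), Measurable
      (K.indicator (fun x => ENNReal.ofReal (gdens n (x + z)))) := fun z =>
    (hgm.comp (measurable_id.add_const z)).indicator hm
  have key := pl_euc n (K.indicator (fun x => ENNReal.ofReal (gdens n (x + z))))
    (K.indicator (fun x => ENNReal.ofReal (gdens n (x + -z))))
    (K.indicator (fun x => ENNReal.ofReal (gdens n x))) (hmz z) (hmz (-z)) (hgm.indicator hm) (by
      intro x y
      by_cases hx : x ∈ K
      · by_cases hy : y ∈ K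
        · have hxy : (1 / 2 : ℝ) • (x + y) ∈ K := by
            rw [smul_add]
            exact hc hx hy (by norm_num) (by norm_num) (by norm_num)
          rw [Set.indicator_of_mem hx, Set.indicator_of_mem hy, Set.indicator_of_mem hxy,
            ← ENNReal.ofReal_mul (gdens_pos n _).le, ← ENNReal.ofReal_pow (gdens_pos n _).le]
          apply ENNReal.ofReal_le_ofReal
          have := gdens_mid n (x + z) (y + -z)
          rwa [show x + z + (y + -z) = x + y by abel] at this
        · rw [Set.indicator_of_notMem hy, mul_zero]; exact zero_le
      · rw [Set.indicator_of_notMem hx, zero_mul]; exact zero_le)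
  have hsym : ∫⁻ x, K.indicator (fun x => ENNReal.ofReal (gdens n (x + -z))) x
      = ∫⁻ x, K.indicator (fun x => ENNReal.ofReal (gdens n (x + z))) x := by
    rw [← (Measure.measurePreserving_neg (volume : Measure (EuclideanSpace ℝ (Fin n)))).lintegral_comp
      (hmz z)]
    congr 1; ext x
    have hiff : -x ∈ K ↔ x ∈ K := ⟨fun h => by simpa using hs _ h, hs x⟩
    by_cases hx : x ∈ K
    · rw [Set.indicator_of_mem hx, Set.indicator_of_mem (hiff.2 hx)]
      have : gdens n (x + -z) = gdens n (-x + z) := by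
        unfold gdens
        rw [← norm_neg (-x + z)]
        congr 5; abel_nf
      rw [this]
    · rw [Set.indicator_of_notMem hx, Set.indicator_of_notMem (fun h => hx (hiff.1 h))]
  rw [hsym, ← hK, ← sq] at key
  rw [conv z]
  exact (ENNReal.pow_le_pow_left_iff two_ne_zero).1 key

lemma inner_sq_integrable (n : ℕ) (e : EuclideanSpace ℝ (Fin n)) :
    Integrable (fun x => (inner ℝ x e : ℝ) ^ 2) (_root_.stdGaussian n) := by
  have hm : MemLp (fun x : EuclideanSpace ℝ (Fin n) => (inner ℝ x e : ℝ)) 2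
    (_root_.stdGaussian n) := by
    have h := (innerSL ℝ e).comp_memLp' (IsGaussian.memLp_two_id (μ := _root_.stdGaussian n))
    have h2 : (fun x : EuclideanSpace ℝ (Fin n) => (inner ℝ x e : ℝ)) = (innerSL ℝ e) ∘ id := by
      ext x
      simp [innerSL_apply_apply, real_inner_comm]
    rw [h2]; exact h
  exact hm.integrable_sq

lemma norm_sq_integrable (n : ℕ) :
    Integrable (fun x => ‖x‖ ^ 2) (_root_.stdGaussian n) :=
  (IsGaussian.memLp_two_id (μ := _root_.stdGaussian n)).integrable_norm_pow two_ne_zero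

lemma second_moment (n : ℕ) (K : Set (EuclideanSpace ℝ (Fin n))) (hc : Convex ℝ K)
    (hs : ∀ x ∈ K, -x ∈ K) (hm : MeasurableSet K) (e : EuclideanSpace ℝ (Fin n)) (he : ‖e‖ = 1) :
    ∫ x in K, (inner ℝ x e : ℝ) ^ 2 ∂(_root_.stdGaussian n) ≤ (_root_.stdGaussian n).real K := by
  have hi := (inner_sq_integrable n e).integrableOn (s := K)
  set Q := ∫ x in K, (inner ℝ x e : ℝ) ^ 2 ∂(_root_.stdGaussian n) with hQ
  set v := (_root_.stdGaussian n).real K with hv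
  have hQ0 : 0 ≤ Q := integral_nonneg fun x => sq_nonneg _
  have step : ∀ s : ℝ, 0 < s → s ^ 2 * Q ≤ 2 * (Real.exp (s ^ 2 / 2) - 1) * v := by
    intro s hs0
    have a1 := anderson n K hc hs hm (s • e)
    have a2 := anderson n K hc hs hm ((-s) • e)
    have hint : Integrable (fun x => 2 + s ^ 2 * (inner ℝ x e : ℝ) ^ 2)
        ((_root_.stdGaussian n).restrict K) := (integrable_const _).add (hi.const_mul _)
    have e1 : ∫ x in K, (2 + s ^ 2 * (inner ℝ x e : ℝ) ^ 2) ∂(_root_.stdGaussian n)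
        = 2 * v + s ^ 2 * Q := by
      rw [integral_add (integrable_const _) (hi.const_mul _), integral_const_mul, integral_const,
        measureReal_restrict_apply_univ, ← hQ, ← hv, smul_eq_mul, mul_comm v]
    have e2 : ENNReal.ofReal (2 * v + s ^ 2 * Q)
        ≤ ENNReal.ofReal (Real.exp (s ^ 2 / 2) * (v + v)) := by
      rw [← e1, ofReal_integral_eq_lintegral_ofReal hint
        (Filter.Eventually.of_forall fun x => by positivity)]
      calc _ ≤ ∫⁻ x in K, ENNReal.ofReal (Real.exp (s ^ 2 / 2)) *
            (ENNReal.ofReal (Real.exp (-inner ℝ x (s • e) - ‖s • e‖ ^ 2 / 2)) +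
             ENNReal.ofReal (Real.exp (-inner ℝ x ((-s) • e) - ‖(-s) • e‖ ^ 2 / 2)))
              ∂(_root_.stdGaussian n) := by
            refine lintegral_mono fun x => ?_
            rw [← ENNReal.ofReal_add (by positivity) (by positivity),
              ← ENNReal.ofReal_mul (by positivity)]
            apply ENNReal.ofReal_le_ofReal
            rw [norm_smul, norm_smul, he, inner_smul_right, inner_smul_right, mul_add,
              ← Real.exp_add, ← Real.exp_add]
            have hcosh := one_add_sq_le_cosh (s * inner ℝ x e)
            rw [Real.cosh_eq] at hcosh
            simp only [norm_neg, mul_one, Real.norm_eq_abs, sq_abs]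
            rw [show s ^ 2 / 2 + (-(s * inner ℝ x e) - s ^ 2 / 2) = -(s * inner ℝ x e) by ring,
              show s ^ 2 / 2 + (-(-s * inner ℝ x e) - s ^ 2 / 2) = (s * inner ℝ x e) by ring]
            nlinarith
        _ ≤ _ := by
            rw [lintegral_const_mul _ (by fun_prop), lintegral_add_left (by fun_prop),
              ENNReal.ofReal_mul (by positivity), ENNReal.ofReal_add measureReal_nonneg
              measureReal_nonneg, ofReal_measureReal]
            gcongr
    rw [ENNReal.ofReal_le_ofReal_iff (by positivity)] at e2
    linarith
  have step2 : ∀ y : ℝ, 0 < y → y < 1 → (1 - y) * Q ≤ v := by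
    intro y h0 h1
    have h := step (√(2 * y)) (by positivity)
    rw [Real.sq_sqrt (by positivity), show 2 * y / 2 = y by ring] at h
    have h2 : Real.exp y * (1 - y) ≤ 1 := by
      have := Real.add_one_le_exp (-y)
      calc Real.exp y * (1 - y) ≤ Real.exp y * Real.exp (-y) := by
            gcongr; linarith
        _ = 1 := by rw [← Real.exp_add]; simp
    have hv0 : 0 ≤ v := measureReal_nonneg
    have h3 : (Real.exp y - 1) * (1 - y) ≤ y := by nlinarith
    have h4 : y * ((1 - y) * Q) ≤ y * v := by
      have := mul_le_mul_of_nonneg_left h (show 0 ≤ 1 - y by linarith)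
      nlinarith [mul_le_mul_of_nonneg_right h3 hv0]
    exact le_of_mul_le_mul_left h4 h0
  by_contra hcon
  push Not at hcon
  have hv0 : 0 ≤ v := measureReal_nonneg
  have hQp : 0 < Q := lt_of_le_of_lt hv0 hcon
  have := step2 ((Q - v) / (2 * Q)) (by apply div_pos <;> linarith)
    (by rw [div_lt_one (by linarith)]; linarith)
  have h5 : (1 - (Q - v) / (2 * Q)) * Q = (Q + v) / 2 := by field_simp; ring
  linarith
lemma stdG_ac (n : ℕ) : _root_.stdGaussian n ≪ volume := by
  rw [stdG_def]; exact withDensity_absolutelyContinuous _ _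

/-- rotated variable -/
noncomputable def rotv {n : ℕ} (t : ℝ) (p : EuclideanSpace ℝ (Fin n) × EuclideanSpace ℝ (Fin n)) :
    EuclideanSpace ℝ (Fin n) := Real.cos t • p.1 + Real.sin t • p.2

lemma rotv_cont {n : ℕ} (t : ℝ) : Continuous (rotv (n := n) t) := by
  unfold rotv; fun_prop

lemma rotv_rotation {n : ℕ} (s t : ℝ)
    (p : EuclideanSpace ℝ (Fin n) × EuclideanSpace ℝ (Fin n)) :
    rotv s (ContinuousLinearMap.rotation t p) = rotv (s + t) p := by
  simp only [rotv, ContinuousLinearMap.rotation_apply, Real.cos_add, Real.sin_add]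
  module

lemma norm_rotv_le {n : ℕ} (t : ℝ) (p : EuclideanSpace ℝ (Fin n) × EuclideanSpace ℝ (Fin n)) :
    ‖rotv t p‖ ≤ ‖p.1‖ + ‖p.2‖ := by
  unfold rotv
  refine (norm_add_le _ _).trans ?_
  rw [norm_smul, norm_smul]
  have h1 := Real.abs_cos_le_one t
  have h2 := Real.abs_sin_le_one t
  simp only [Real.norm_eq_abs]
  nlinarith [norm_nonneg p.1, norm_nonneg p.2]

lemma norm_int_prod (n : ℕ) : Integrable (fun p : EuclideanSpace ℝ (Fin n) ×
    EuclideanSpace ℝ (Fin n) => ‖p.1‖ + ‖p.2‖)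
    ((_root_.stdGaussian n).prod (_root_.stdGaussian n)) := by
  have h := (IsGaussian.integrable_id (μ := _root_.stdGaussian n)).norm
  exact (h.comp_fst _).add (h.comp_snd _)

lemma rot_diff_integrable (n : ℕ) (f : EuclideanSpace ℝ (Fin n) → ℝ) (C : NNReal)
    (hf : LipschitzWith C f) (s t : ℝ) :
    Integrable (fun p => |f (rotv s p) - f (rotv t p)|)
    ((_root_.stdGaussian n).prod (_root_.stdGaussian n)) := by
  refine ((norm_int_prod n).const_mul (2 * C)).mono' ?_ ?_
  · have := hf.continuous
    have h1 := this.comp (rotv_cont (n := n) s)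
    have h2 := this.comp (rotv_cont (n := n) t)
    exact (h1.sub h2).abs.aestronglyMeasurable
  · refine Filter.Eventually.of_forall fun p => ?_
    have h := hf.dist_le_mul (rotv s p) (rotv t p)
    rw [Real.dist_eq, dist_eq_norm] at h
    rw [Real.norm_eq_abs, abs_abs]
    have h3 : ‖rotv s p - rotv t p‖ ≤ 2 * (‖p.1‖ + ‖p.2‖) := by
      have := norm_sub_le (rotv s p) (rotv t p)
      linarith [norm_rotv_le s p, norm_rotv_le t p]
    have := mul_le_mul_of_nonneg_left h3 C.coe_nonneg
    linarith

lemma rot_step (n : ℕ) (f : EuclideanSpace ℝ (Fin n) → ℝ) (C : NNReal)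
    (hf : LipschitzWith C f) (N : ℕ) (hN : 0 < N) :
    ∫ p, |f p.1 - f p.2| ∂((_root_.stdGaussian n).prod (_root_.stdGaussian n)) ≤
      N * ∫ p, |f (rotv (π / (2 * N)) p) - f p.1|
        ∂((_root_.stdGaussian n).prod (_root_.stdGaussian n)) := by
  set μ := (_root_.stdGaussian n).prod (_root_.stdGaussian n)
  set a := π / (2 * N) with ha
  have hNa : (N : ℝ) * a = π / 2 := by rw [ha]; field_simp
  have hk : ∀ k : ℕ, ∫ p, |f (rotv ((k + 1 : ℕ) * a) p) - f (rotv (k * a) p)| ∂μ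
      = ∫ p, |f (rotv a p) - f p.1| ∂μ := by
    intro k
    have hr := stdG_rotation n (k * a)
    have hcont : Continuous fun p : EuclideanSpace ℝ (Fin n) × EuclideanSpace ℝ (Fin n) =>
        |f (rotv a p) - f p.1| := by
      have := hf.continuous
      have h1 := this.comp (rotv_cont (n := n) a)
      exact (h1.sub (this.comp continuous_fst)).abs
    conv_rhs => rw [show μ = μ.map (ContinuousLinearMap.rotation (k * a)) from hr.symm]
    rw [integral_map (by fun_prop) hcont.aestronglyMeasurable]
    congr 1; ext p
    rw [rotv_rotation]
    have h2 : (ContinuousLinearMap.rotation (k * a) p).1 = rotv (k * a) p := rfl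
    rw [h2]
    push_cast
    rw [show (k + 1 : ℝ) * a = a + k * a by ring]
  calc ∫ p, |f p.1 - f p.2| ∂μ
      ≤ ∫ p, ∑ k ∈ Finset.range N, |f (rotv ((k + 1 : ℕ) * a) p) - f (rotv (k * a) p)| ∂μ := by
        refine integral_mono_of_nonneg (Filter.Eventually.of_forall fun p => abs_nonneg _)
          (integrable_finsetSum _ fun k _ => rot_diff_integrable n f C hf _ _)
          (Filter.Eventually.of_forall fun p => ?_)
        have h0 := Finset.sum_range_sub (fun k : ℕ => f (rotv (k * a) p)) N
        have e0 : rotv ((0 : ℕ) * a) p = p.1 := by simp [rotv]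
        have e1 : rotv ((N : ℕ) * a) p = p.2 := by rw [hNa]; simp [rotv]
        rw [e0, e1] at h0
        beta_reduce
        rw [abs_sub_comm, ← h0]
        exact Finset.abs_sum_le_sum_abs _ _
    _ = N * ∫ p, |f (rotv a p) - f p.1| ∂μ := by
        rw [integral_finsetSum _ fun k _ => rot_diff_integrable n f C hf _ _]
        rw [Finset.sum_congr rfl fun k _ => hk k]
        simp

lemma l1_poincare (n : ℕ) (f : EuclideanSpace ℝ (Fin n) → ℝ) (C : NNReal)
    (hf : LipschitzWith C f) :
    ∫ p, |f p.1 - f p.2| ∂((_root_.stdGaussian n).prod (_root_.stdGaussian n)) ≤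
      π / 2 * ∫ x, ‖fderiv ℝ f x‖ ∂(_root_.stdGaussian n) := by
  set γ := _root_.stdGaussian n
  set μ := γ.prod γ with hμ
  have hd : ∀ᵐ p ∂μ, DifferentiableAt ℝ f p.1 := by
    have h1 : ∀ᵐ x ∂γ, DifferentiableAt ℝ f x := (stdG_ac n).ae_le hf.ae_differentiableAt
    exact Measure.quasiMeasurePreserving_fst.ae h1
  have hap : ∀ N : ℕ, 0 < N → (0 : ℝ) < π / (2 * N) := fun N hN => by positivity
  have hlim : Filter.Tendsto (fun N : ℕ => ∫ p, N * |f (rotv (π / (2 * N)) p) - f p.1| ∂μ)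
      Filter.atTop (nhds (∫ p, π / 2 * |fderiv ℝ f p.1 p.2| ∂μ)) := by
    refine tendsto_integral_of_dominated_convergence
      (fun p => π / 2 * C * (‖p.1‖ + ‖p.2‖)) ?_ ((norm_int_prod n).const_mul _) ?_ ?_
    · intro N
      have := hf.continuous
      have h1 := this.comp (rotv_cont (n := n) (π / (2 * N)))
      exact (continuous_const.mul (h1.sub (this.comp continuous_fst)).abs).aestronglyMeasurable
    · intro N
      refine Filter.Eventually.of_forall fun p => ?_
      rcases Nat.eq_zero_or_pos N with rfl | hN
      · simp; positivity
      have ha := hap N hN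
      have hNa : (N : ℝ) * (π / (2 * N)) = π / 2 := by field_simp
      have ha2 : π / (2 * N) ≤ 2 := by
        have h1 : (1 : ℝ) ≤ N := by exact_mod_cast hN
        rw [div_le_iff₀ (by positivity)]
        nlinarith [Real.pi_le_four]
      set a := π / (2 * (N : ℝ))
      have h := hf.dist_le_mul (rotv a p) p.1
      rw [Real.dist_eq, dist_eq_norm] at h
      have h3 : ‖rotv a p - p.1‖ ≤ a * (‖p.1‖ + ‖p.2‖) := by
        have e : rotv a p - p.1 = (Real.cos a - 1) • p.1 + Real.sin a • p.2 := by
          unfold rotv; module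
        rw [e]
        refine (norm_add_le _ _).trans ?_
        rw [norm_smul, norm_smul, mul_add, Real.norm_eq_abs, Real.norm_eq_abs]
        have c1 : |Real.cos a - 1| ≤ a := by
          rw [abs_le]
          have := Real.one_sub_sq_div_two_le_cos (x := a)
          constructor
          · nlinarith
          · linarith [Real.cos_le_one a]
        have c2 : |Real.sin a| ≤ a := by
          have := Real.abs_sin_le_abs (x := a)
          rwa [abs_of_pos ha] at this
        gcongr
      rw [Real.norm_eq_abs, abs_mul, abs_abs, Nat.abs_cast]
      calc (N : ℝ) * |f (rotv a p) - f p.1| ≤ N * (C * (a * (‖p.1‖ + ‖p.2‖))) := by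
            gcongr; exact h.trans (by gcongr)
        _ = (N * a) * C * (‖p.1‖ + ‖p.2‖) := by ring
        _ = _ := by rw [hNa]
    · filter_upwards [hd] with p hp
      have hcurve : HasDerivAt (fun t => rotv t p) p.2 0 := by
        have h1 : HasDerivAt (fun t => Real.cos t • p.1 + Real.sin t • p.2)
            (-Real.sin 0 • p.1 + Real.cos 0 • p.2) 0 :=
          ((Real.hasDerivAt_cos 0).smul_const p.1).add ((Real.hasDerivAt_sin 0).smul_const p.2)
        simpa [rotv] using h1
      have hr0 : rotv 0 p = p.1 := by simp [rotv]
      have hF : HasDerivAt (fun t => f (rotv t p)) (fderiv ℝ f p.1 p.2) 0 := by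
        have h2 : HasFDerivAt f (fderiv ℝ f p.1) (rotv 0 p) := by rw [hr0]; exact hp.hasFDerivAt
        exact h2.comp_hasDerivAt 0 hcurve
      have hsl := hF.tendsto_slope_zero
      have hseq : Filter.Tendsto (fun N : ℕ => π / (2 * (N : ℝ))) Filter.atTop
          (nhdsWithin 0 {0}ᶜ) := by
        refine tendsto_nhdsWithin_iff.2 ⟨?_, ?_⟩
        · refine Filter.Tendsto.const_div_atTop ?_ _
          exact tendsto_natCast_atTop_atTop.const_mul_atTop (by norm_num)
        · filter_upwards [Filter.eventually_gt_atTop 0] with N hN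
          exact (hap N hN).ne'
      have h3 := ((hsl.comp hseq).abs).const_mul (π / 2)
      refine h3.congr' ?_
      filter_upwards [Filter.eventually_gt_atTop 0] with N hN
      have ha := hap N hN
      have hNa : (N : ℝ) * (π / (2 * N)) = π / 2 := by field_simp
      simp only [Function.comp_apply, zero_add, smul_eq_mul, hr0]
      rw [abs_mul, abs_of_pos (inv_pos.2 ha), ← hNa]
      field_simp
  have hle : ∫ p, |f p.1 - f p.2| ∂μ ≤ ∫ p, π / 2 * |fderiv ℝ f p.1 p.2| ∂μ := by
    refine ge_of_tendsto hlim ?_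
    filter_upwards [Filter.eventually_gt_atTop 0] with N hN
    rw [integral_const_mul]
    exact rot_step n f C hf N hN
  refine hle.trans ?_
  rw [integral_const_mul]
  gcongr
  have hmeas : Measurable fun p : EuclideanSpace ℝ (Fin n) × EuclideanSpace ℝ (Fin n) =>
      fderiv ℝ f p.1 p.2 := by
    have h1 : Measurable fun p : EuclideanSpace ℝ (Fin n) × EuclideanSpace ℝ (Fin n) =>
      (fderiv ℝ f p.1, p.2) := ((measurable_fderiv ℝ f).comp measurable_fst).prodMk measurable_snd
    exact isBoundedBilinearMap_apply.continuous.measurable.comp h1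
  have hb : ∀ x, ‖fderiv ℝ f x‖ ≤ C := fun x => norm_fderiv_le_of_lipschitz ℝ hf
  have hint : Integrable (fun p : EuclideanSpace ℝ (Fin n) × EuclideanSpace ℝ (Fin n) =>
      |fderiv ℝ f p.1 p.2|) μ := by
    refine ((norm_int_prod n).const_mul C).mono' hmeas.abs.aestronglyMeasurable
      (Filter.Eventually.of_forall fun p => ?_)
    rw [Real.norm_eq_abs, abs_abs]
    have := (fderiv ℝ f p.1).le_opNorm p.2
    rw [Real.norm_eq_abs] at this
    nlinarith [hb p.1, norm_nonneg p.1, norm_nonneg p.2, C.coe_nonneg]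
  rw [hμ, integral_prod _ hint]
  refine integral_mono_of_nonneg (Filter.Eventually.of_forall fun x =>
    integral_nonneg fun y => abs_nonneg _) ?_ (Filter.Eventually.of_forall fun x =>
    stdG_abs_le n (fderiv ℝ f x))
  refine (integrable_const (C : ℝ)).mono' (measurable_fderiv ℝ f).norm.aestronglyMeasurable
    (Filter.Eventually.of_forall fun x => ?_)
  simpa using hb x
lemma fat_iso (n : ℕ) (K : Set (EuclideanSpace ℝ (Fin n))) (hc : Convex ℝ K) (hcl : IsClosed K)
    (r : ℝ) (hr : 0 < r) (hb : Metric.closedBall 0 r ⊆ K) (h : ℝ) (hh : 0 < h) :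
    (_root_.stdGaussian n).real K *
        (1 - (_root_.stdGaussian n).real {x | (1 + h)⁻¹ • x ∈ K}) ≤
      π / 2 / (r * h) * ((_root_.stdGaussian n).real {x | (1 + h)⁻¹ • x ∈ K}
        - (_root_.stdGaussian n).real K) := by
  set γ := _root_.stdGaussian n with hγ
  set W := {x : EuclideanSpace ℝ (Fin n) | (1 + h)⁻¹ • x ∈ K} with hW
  have hWcl : IsClosed W := hcl.preimage (continuous_const_smul _)
  have h0K : (0 : EuclideanSpace ℝ (Fin n)) ∈ K := hb (by simp [hr.le])
  have hKne : K.Nonempty := ⟨0, h0K⟩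
  have h1h : 0 < 1 + h := by linarith
  have hKW : K ⊆ W := by
    intro x hx
    refine hc.smul_mem_of_zero_mem h0K hx ⟨by positivity, ?_⟩
    exact inv_le_one_of_one_le₀ (by linarith)
  set δ := r * h with hδ
  have hδp : 0 < δ := by positivity
  set f : EuclideanSpace ℝ (Fin n) → ℝ := fun x => max 0 (1 - Metric.infDist x K / δ) with hf
  have hfn : ∀ x, 0 ≤ f x := fun x => le_max_left _ _
  have hf1 : ∀ x, f x ≤ 1 := fun x => by
    refine max_le (by norm_num) ?_
    have : 0 ≤ Metric.infDist x K / δ := div_nonneg Metric.infDist_nonneg hδp.le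
    linarith
  have hfK : ∀ x ∈ K, f x = 1 := fun x hx => by
    simp [hf, Metric.infDist_zero_of_mem hx]
  have hfW : ∀ x, x ∉ W → f x = 0 := by
    intro x hx
    refine max_eq_left ?_
    have : δ ≤ Metric.infDist x K := by
      by_contra! hlt
      obtain ⟨k, hk, hxk⟩ := (Metric.infDist_lt_iff hKne).1 hlt
      apply hx
      have hbK : h⁻¹ • (x - k) ∈ K := by
        apply hb
        rw [mem_closedBall_zero_iff, norm_smul, Real.norm_eq_abs, abs_of_pos (inv_pos.2 hh),
          ← dist_eq_norm, inv_mul_le_iff₀ hh]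
        rw [hδ] at hxk
        linarith
      have := hc hk hbK (a := (1 + h)⁻¹) (b := h * (1 + h)⁻¹) (by positivity) (by positivity)
        (by field_simp)
      have e : (1 + h)⁻¹ • x = (1 + h)⁻¹ • k + (h * (1 + h)⁻¹) • h⁻¹ • (x - k) := by
        rw [smul_smul, show h * (1 + h)⁻¹ * h⁻¹ = (1 + h)⁻¹ by field_simp]
        module
      show (1 + h)⁻¹ • x ∈ K
      rw [e]; exact this
    have := (one_le_div hδp).2 this
    linarith
  have hδi : 0 ≤ δ⁻¹ := by positivity
  have hL : LipschitzWith ⟨δ⁻¹, hδi⟩ f := by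
    refine LipschitzWith.of_dist_le_mul fun x y => ?_
    have h1 := (Metric.lipschitz_infDist_pt K).dist_le_mul x y
    rw [Real.dist_eq] at h1 ⊢
    have h2 : |f x - f y| ≤ |(1 - Metric.infDist x K / δ) - (1 - Metric.infDist y K / δ)| := by
      have := abs_max_sub_max_le_max 0 (1 - Metric.infDist x K / δ) 0 (1 - Metric.infDist y K / δ)
      simpa [hf] using this
    refine h2.trans ?_
    have e : (1 - Metric.infDist x K / δ) - (1 - Metric.infDist y K / δ)
      = -(δ⁻¹ * (Metric.infDist x K - Metric.infDist y K)) := by field_simp; ring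
    rw [e, abs_neg, abs_mul, abs_of_nonneg hδi]
    have : |Metric.infDist x K - Metric.infDist y K| ≤ dist x y := by simpa using h1
    show _ ≤ δ⁻¹ * dist x y
    gcongr
  have hp := l1_poincare n f _ hL
  have hKm := hcl.measurableSet
  have hWm := hWcl.measurableSet
  have hlow : γ.real K * (1 - γ.real W) ≤ ∫ p, |f p.1 - f p.2| ∂(γ.prod γ) := by
    have e1 : γ.real K * (1 - γ.real W) = (γ.prod γ).real (K ×ˢ Wᶜ) := by
      rw [measureReal_prod_prod, probReal_compl_eq_one_sub hWm]
    rw [e1, ← integral_indicator_one (hKm.prod hWm.compl)]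
    refine integral_mono_of_nonneg (Filter.Eventually.of_forall fun p =>
      Set.indicator_nonneg (fun _ _ => zero_le_one) _) ?_ (Filter.Eventually.of_forall fun p => ?_)
    · have hcf := hL.continuous
      refine (integrable_const (1 : ℝ)).mono'
        ((hcf.comp continuous_fst).sub (hcf.comp continuous_snd)).abs.aestronglyMeasurable
        (Filter.Eventually.of_forall fun p => ?_)
      rw [Real.norm_eq_abs, abs_abs, abs_le]
      constructor <;> linarith [hfn p.1, hfn p.2, hf1 p.1, hf1 p.2]
    · beta_reduce
      by_cases hp : p ∈ K ×ˢ Wᶜ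
      · rw [Set.indicator_of_mem hp, hfK _ hp.1, hfW _ hp.2]; simp
      · rw [Set.indicator_of_notMem hp]; exact abs_nonneg _
  have hup : ∫ x, ‖fderiv ℝ f x‖ ∂γ ≤ δ⁻¹ * (γ.real W - γ.real K) := by
    have e2 : δ⁻¹ * (γ.real W - γ.real K) = ∫ x, (W \ K).indicator (fun _ => δ⁻¹) x ∂γ := by
      rw [integral_indicator_const _ (hWm.diff hKm), measureReal_sdiff hKW hKm, smul_eq_mul, mul_comm]
    rw [e2]
    refine integral_mono_of_nonneg (Filter.Eventually.of_forall fun p => norm_nonneg _)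
      ((integrable_const _).indicator (hWm.diff hKm)) (Filter.Eventually.of_forall fun x => ?_)
    beta_reduce
    by_cases hx : x ∈ W \ K
    · rw [Set.indicator_of_mem hx]
      exact norm_fderiv_le_of_lipschitz ℝ hL
    · rw [Set.indicator_of_notMem hx]
      have : fderiv ℝ f x = 0 := by
        by_cases hxK : x ∈ K
        · apply IsLocalMax.fderiv_eq_zero
          exact Filter.Eventually.of_forall fun y => by rw [hfK x hxK]; exact hf1 y
        · have hxW : x ∉ W := fun hw => hx ⟨hw, hxK⟩
          apply IsLocalMin.fderiv_eq_zero
          exact Filter.Eventually.of_forall fun y => by rw [hfW x hxW]; exact hfn y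
      simp [this]
  calc _ ≤ _ := hlow
    _ ≤ _ := hp
    _ ≤ π / 2 * (δ⁻¹ * (γ.real W - γ.real K)) := by gcongr
    _ = _ := by ring
lemma stdG_setInt (n : ℕ) (S : Set (EuclideanSpace ℝ (Fin n))) (hS : MeasurableSet S)
    (g : EuclideanSpace ℝ (Fin n) → ℝ) :
    ∫ x in S, g x ∂(_root_.stdGaussian n) = ∫ x in S, gdens n x * g x := by
  have hm : Measurable (fun x => (gdens n x).toNNReal) := (gdens_cont n).measurable.real_toNNReal
  rw [stdG_def]
  have := setIntegral_withDensity_eq_setIntegral_smul (μ := volume) hm g hS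
  rw [show (fun x => ENNReal.ofReal (gdens n x)) = fun x => ((gdens n x).toNNReal : ENNReal) from rfl,
    this]
  congr 1; ext x
  rw [NNReal.smul_def, Real.coe_toNNReal _ (gdens_pos n x).le, smul_eq_mul]

lemma stdG_integrable (n : ℕ) (g : EuclideanSpace ℝ (Fin n) → ℝ)
    (hg : Integrable g (_root_.stdGaussian n)) : Integrable (fun x => gdens n x * g x) := by
  have hm : Measurable (fun x => (gdens n x).toNNReal) := (gdens_cont n).measurable.real_toNNReal
  rw [stdG_def] at hg
  have := (integrable_withDensity_iff_integrable_smul (μ := volume) hm).1 hg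
  refine this.congr (Filter.Eventually.of_forall fun x => ?_)
  beta_reduce
  rw [NNReal.smul_def, Real.coe_toNNReal _ (gdens_pos n x).le, smul_eq_mul]

lemma exp_quad (y : ℝ) (hy : y ≤ 1) : Real.exp y ≤ 1 + y + y ^ 2 := by
  rcases le_or_gt (-1) y with h | h
  · have := Real.abs_exp_sub_one_sub_id_le (x := y) (abs_le.2 ⟨h, hy⟩)
    linarith [(abs_le.1 this).2]
  · have : Real.exp y ≤ 1 := Real.exp_le_one_iff.2 (by linarith)
    nlinarith

lemma sq_int (n : ℕ) : Integrable (fun x : EuclideanSpace ℝ (Fin n) => ((n : ℝ) - ‖x‖ ^ 2) ^ 2)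
    (_root_.stdGaussian n) := by
  have h4 : Integrable (fun x : EuclideanSpace ℝ (Fin n) => ‖x‖ ^ 4) (_root_.stdGaussian n) :=
    MemLp.integrable_norm_pow (p := 4) (f := id)
      (IsGaussian.memLp_id (_root_.stdGaussian n) _ (by simp)) (by norm_num)
  have h2 := norm_sq_integrable n
  have := ((integrable_const ((n : ℝ) ^ 2)).sub (h2.const_mul (2 * n))).add h4
  refine this.congr (Filter.Eventually.of_forall fun x => ?_)
  simp only [Pi.add_apply, Pi.sub_apply]
  ring

open scoped Pointwise in
lemma dilation (n : ℕ) (K : Set (EuclideanSpace ℝ (Fin n))) (hm : MeasurableSet K)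
    (h : ℝ) (hh : 0 < h) (hn : h * n ≤ 1) :
    (_root_.stdGaussian n).real {x | (1 + h)⁻¹ • x ∈ K} ≤ (_root_.stdGaussian n).real K
      + h * (∫ x in K, ((n : ℝ) - ‖x‖ ^ 2) ∂(_root_.stdGaussian n))
      + h ^ 2 * (∫ x in K, ((n : ℝ) - ‖x‖ ^ 2) ^ 2 ∂(_root_.stdGaussian n)) := by
  have h1h : 0 < 1 + h := by linarith
  have hWm : MeasurableSet {x : EuclideanSpace ℝ (Fin n) | (1 + h)⁻¹ • x ∈ K} :=
    hm.preimage (measurable_const_smul _)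
  have hWe : (1 + h) • K = {x : EuclideanSpace ℝ (Fin n) | (1 + h)⁻¹ • x ∈ K} := by
    ext x
    exact Set.mem_smul_set_iff_inv_smul_mem₀ h1h.ne' K x
  have e1 : (_root_.stdGaussian n).real {x | (1 + h)⁻¹ • x ∈ K}
      = ∫ x in K, (1 + h) ^ n * gdens n ((1 + h) • x) := by
    have a1 := stdG_setInt n _ hWm (fun _ => 1)
    rw [setIntegral_const, smul_eq_mul, mul_one] at a1
    rw [a1, integral_const_mul, Measure.setIntegral_comp_smul_of_pos volume (gdens n) K h1h,
      hWe, finrank_euclideanSpace_fin, smul_eq_mul, ← mul_assoc,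
      mul_inv_cancel₀ (by positivity), one_mul]
    simp
  have i1 : Integrable (fun x : EuclideanSpace ℝ (Fin n) => (n : ℝ) - ‖x‖ ^ 2)
    (_root_.stdGaussian n) := (integrable_const _).sub (norm_sq_integrable n)
  have i2 := sq_int n
  have i0 : Integrable (fun x : EuclideanSpace ℝ (Fin n) => (1 : ℝ))
    (_root_.stdGaussian n) := integrable_const _
  have i3 : Integrable (fun x : EuclideanSpace ℝ (Fin n) => 1 + h * ((n : ℝ) - ‖x‖ ^ 2)
      + h ^ 2 * ((n : ℝ) - ‖x‖ ^ 2) ^ 2) (_root_.stdGaussian n) :=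
    (i0.add (i1.const_mul h)).add (i2.const_mul (h ^ 2))
  have i4 : Integrable (fun x : EuclideanSpace ℝ (Fin n) => 1 + h * ((n : ℝ) - ‖x‖ ^ 2))
      (_root_.stdGaussian n) := i0.add (i1.const_mul h)
  have e2 : (_root_.stdGaussian n).real K
      + h * (∫ x in K, ((n : ℝ) - ‖x‖ ^ 2) ∂(_root_.stdGaussian n))
      + h ^ 2 * (∫ x in K, ((n : ℝ) - ‖x‖ ^ 2) ^ 2 ∂(_root_.stdGaussian n))
      = ∫ x in K, gdens n x * (1 + h * ((n : ℝ) - ‖x‖ ^ 2)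
      + h ^ 2 * ((n : ℝ) - ‖x‖ ^ 2) ^ 2) := by
    rw [← stdG_setInt n K hm, integral_add (f := fun x => 1 + h * ((n : ℝ) - ‖x‖ ^ 2))
      i4.integrableOn
      (i2.const_mul (h ^ 2)).integrableOn, integral_add i0.integrableOn
      (i1.const_mul h).integrableOn, integral_const_mul, integral_const_mul, setIntegral_const]
    simp
  rw [e1, e2]
  refine integral_mono_of_nonneg (Filter.Eventually.of_forall fun x => ?_)
    (stdG_integrable n _ i3).integrableOn (Filter.Eventually.of_forall fun x => ?_)
  · have := gdens_pos n ((1 + h) • x)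
    show 0 ≤ (1 + h) ^ n * gdens n ((1 + h) • x)
    positivity
  · beta_reduce
    have hx2 : 0 ≤ ‖x‖ ^ 2 := by positivity
    have b1 : (1 + h) ^ n ≤ Real.exp (n * h) := by
      rw [Real.exp_nat_mul]
      have := Real.add_one_le_exp h
      gcongr; linarith
    have b2 : gdens n ((1 + h) • x) ≤ gdens n x * Real.exp (-h * ‖x‖ ^ 2) := by
      unfold gdens
      rw [mul_assoc, ← Real.exp_add, norm_smul, Real.norm_eq_abs, abs_of_pos h1h]
      gcongr
      nlinarith [mul_nonneg (sq_nonneg h) hx2]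
    have b3 := exp_quad (h * ((n : ℝ) - ‖x‖ ^ 2)) (by nlinarith)
    have hg := (gdens_pos n x).le
    calc (1 + h) ^ n * gdens n ((1 + h) • x)
        ≤ Real.exp (n * h) * (gdens n x * Real.exp (-h * ‖x‖ ^ 2)) := by
          have := (gdens_pos n ((1 + h) • x)).le
          gcongr
      _ = gdens n x * Real.exp (h * ((n : ℝ) - ‖x‖ ^ 2)) := by
          rw [mul_left_comm, ← Real.exp_add]; congr 2; ring
      _ ≤ _ := by
          gcongr
          linarith
lemma narrow (n : ℕ) (K : Set (EuclideanSpace ℝ (Fin n))) (hc : Convex ℝ K)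
    (hs : ∀ x ∈ K, -x ∈ K) (hcl : IsClosed K) (hne : K.Nonempty) (r : ℝ) (hr : 0 < r)
    (hb : ¬ Metric.closedBall 0 r ⊆ K) :
    ∫ x in K, ‖x‖ ^ 2 ∂(_root_.stdGaussian n) ≤
      ((n : ℝ) - 1 + r ^ 2) * (_root_.stdGaussian n).real K := by
  have hm := hcl.measurableSet
  obtain ⟨y, hy, hyK⟩ := Set.not_subset.1 hb
  rw [mem_closedBall_zero_iff] at hy
  obtain ⟨f, u, hf, hu⟩ := geometric_hahn_banach_closed_point hc hcl hyK
  obtain ⟨x0, hx0⟩ := hne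
  have hu0 : 0 < u := by
    have a := hf _ hx0
    have b := hf _ (hs _ hx0)
    rw [map_neg] at b
    linarith
  set z := (InnerProductSpace.toDual ℝ (EuclideanSpace ℝ (Fin n))).symm f with hz
  have hfz : ∀ x, f x = inner ℝ x z := fun x => by
    rw [real_inner_comm, hz, InnerProductSpace.toDual_symm_apply]
  have hz0 : z ≠ 0 := by
    intro h
    rw [hfz, h, inner_zero_right] at hu
    linarith
  have hzn : 0 < ‖z‖ := norm_pos_iff.2 hz0
  set e := ‖z‖⁻¹ • z with he
  have hen : ‖e‖ = 1 := by
    rw [he, norm_smul, norm_inv, norm_norm, inv_mul_cancel₀ hzn.ne']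
  have huz : u ≤ r * ‖z‖ := by
    have h1 := real_inner_le_norm y z
    rw [hfz] at hu
    nlinarith
  have hbd : ∀ x ∈ K, (inner ℝ x e : ℝ) ^ 2 ≤ r ^ 2 := by
    intro x hx
    have a := hf _ hx
    have b := hf _ (hs _ hx)
    rw [map_neg] at b
    rw [hfz] at a b
    rw [he, inner_smul_right]
    have : |‖z‖⁻¹ * (inner ℝ x z : ℝ)| ≤ r := by
      rw [abs_mul, abs_of_pos (inv_pos.2 hzn), inv_mul_le_iff₀ hzn, abs_le]
      constructor <;> nlinarith
    exact sq_le_sq' (abs_le.1 this).1 (abs_le.1 this).2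
  have hpos : 0 < n := by
    rcases Nat.eq_zero_or_pos n with rfl | h
    · exact absurd (Subsingleton.elim z 0) hz0
    · exact h
  obtain ⟨b, hb⟩ := Orthonormal.exists_orthonormalBasis_extension_of_card_eq (𝕜 := ℝ)
    (E := EuclideanSpace ℝ (Fin n)) (ι := Fin n) (by simp) (v := fun _ => e) (s := {⟨0, hpos⟩})
    (by
      rw [orthonormal_iff_ite]
      intro i j
      have : i = j := Subsingleton.elim _ _
      subst this
      simp [hen])
  have hb0 : b ⟨0, hpos⟩ = e := hb _ rfl
  have hsum : ∫ x in K, ‖x‖ ^ 2 ∂(_root_.stdGaussian n)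
      = ∑ i, ∫ x in K, (inner ℝ x (b i) : ℝ) ^ 2 ∂(_root_.stdGaussian n) := by
    rw [← integral_finsetSum _ fun i _ => (inner_sq_integrable n (b i)).integrableOn]
    congr 1; ext x
    exact (b.sum_sq_inner_left x).symm
  have h0 : ∫ x in K, (inner ℝ x (b ⟨0, hpos⟩) : ℝ) ^ 2 ∂(_root_.stdGaussian n)
      ≤ r ^ 2 * (_root_.stdGaussian n).real K := by
    rw [hb0]
    calc _ ≤ ∫ x in K, r ^ 2 ∂(_root_.stdGaussian n) :=
          setIntegral_mono_on (inner_sq_integrable n e).integrableOn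
            (integrable_const _).integrableOn hm hbd
      _ = _ := by rw [setIntegral_const, smul_eq_mul, mul_comm]
  rw [hsum, ← Finset.add_sum_erase _ _ (Finset.mem_univ ⟨0, hpos⟩)]
  have h1 : ∑ i ∈ Finset.univ.erase (⟨0, hpos⟩ : Fin n),
      ∫ x in K, (inner ℝ x (b i) : ℝ) ^ 2 ∂(_root_.stdGaussian n)
      ≤ ((n : ℝ) - 1) * (_root_.stdGaussian n).real K := by
    refine (Finset.sum_le_card_nsmul _ _ ((_root_.stdGaussian n).real K)
      fun i _ => second_moment n K hc hs hm (b i) (b.norm_eq_one i)).trans ?_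
    rw [Finset.card_erase_of_mem (Finset.mem_univ _), nsmul_eq_mul, Finset.card_univ,
      Fintype.card_fin, Nat.cast_sub hpos, Nat.cast_one]
  linarith
lemma closed_case (n : ℕ) (K : Set (EuclideanSpace ℝ (Fin n))) (hc : Convex ℝ K)
    (hs : ∀ x ∈ K, -x ∈ K) (hcl : IsClosed K) (hne : K.Nonempty) (ε : ℝ) (h0 : 0 < ε)
    (h1 : ε ≤ 1) (hv : (_root_.stdGaussian n).real K ≤ 1 - ε) :
    ∫ x in K, ‖x‖ ^ 2 ∂(_root_.stdGaussian n) ≤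
      ((n : ℝ) - 1 / 4 * ε) * (_root_.stdGaussian n).real K := by
  have hm := hcl.measurableSet
  have hv0 : 0 ≤ (_root_.stdGaussian n).real K := measureReal_nonneg
  by_cases hb : Metric.closedBall (0 : EuclideanSpace ℝ (Fin n)) (1 / 2) ⊆ K
  swap
  · refine (narrow n K hc hs hcl hne (1 / 2) (by norm_num) hb).trans ?_
    gcongr
    linarith
  set v := (_root_.stdGaussian n).real K with hvd
  set D := ∫ x in K, ((n : ℝ) - ‖x‖ ^ 2) ∂(_root_.stdGaussian n) with hD
  set M := ∫ x in K, ((n : ℝ) - ‖x‖ ^ 2) ^ 2 ∂(_root_.stdGaussian n) with hM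
  have hDe : D = n * v - ∫ x in K, ‖x‖ ^ 2 ∂(_root_.stdGaussian n) := by
    rw [hD, integral_sub (integrable_const _).integrableOn (norm_sq_integrable n).integrableOn,
      setIntegral_const, smul_eq_mul, mul_comm]
  have key : ∀ h : ℝ, 0 < h → h * n ≤ 1 →
      v * (1 - (v + h * D + h ^ 2 * M)) ≤ π * (D + h * M) := by
    intro h hh hn
    have a := fat_iso n K hc hcl (1 / 2) (by norm_num) hb h hh
    have b := dilation n K hm h hh hn
    rw [← hvd] at a b
    rw [← hD, ← hM] at b
    set w := (_root_.stdGaussian n).real {x | (1 + h)⁻¹ • x ∈ K}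
    calc v * (1 - (v + h * D + h ^ 2 * M)) ≤ v * (1 - w) := by gcongr
      _ ≤ _ := a
      _ ≤ π / 2 / (1 / 2 * h) * (h * D + h ^ 2 * M) := by
          gcongr; linarith
      _ = π * (D + h * M) := by field_simp
  have hlim : v * (1 - v) ≤ π * D := by
    have t1 : Filter.Tendsto (fun h : ℝ => v * (1 - (v + h * D + h ^ 2 * M)))
        (nhdsWithin 0 (Set.Ioi 0)) (nhds (v * (1 - v))) := by
      have : Continuous fun h : ℝ => v * (1 - (v + h * D + h ^ 2 * M)) := by fun_prop
      have := this.tendsto 0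
      simp only [zero_mul, add_zero, ne_eq, OfNat.ofNat_ne_zero, not_false_eq_true, zero_pow] at this
      exact this.mono_left nhdsWithin_le_nhds
    have t2 : Filter.Tendsto (fun h : ℝ => π * (D + h * M))
        (nhdsWithin 0 (Set.Ioi 0)) (nhds (π * D)) := by
      have : Continuous fun h : ℝ => π * (D + h * M) := by fun_prop
      have := this.tendsto 0
      simp only [zero_mul, add_zero] at this
      exact this.mono_left nhdsWithin_le_nhds
    refine le_of_tendsto_of_tendsto t1 t2 ?_
    have hsm : ∀ᶠ h : ℝ in nhdsWithin 0 (Set.Ioi 0), h * n < 1 := by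
      have : Continuous fun h : ℝ => h * (n : ℝ) := by fun_prop
      have := this.tendsto 0
      rw [zero_mul] at this
      exact (this.mono_left nhdsWithin_le_nhds).eventually_lt_const (by norm_num)
    filter_upwards [hsm, self_mem_nhdsWithin] with h a b
    exact key h b a.le
  have hD0 : 0 ≤ D := by
    have : 0 ≤ π * D := le_trans (mul_nonneg hv0 (by linarith)) hlim
    exact nonneg_of_mul_nonneg_right this Real.pi_pos
  have h4 : π * D ≤ 4 * D := mul_le_mul_of_nonneg_right Real.pi_le_four hD0
  have h5 : v * ε ≤ v * (1 - v) := mul_le_mul_of_nonneg_left (by linarith) hv0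
  nlinarith
/-- there is an absolute constant `c > 0` such that for every `n`, every
`ε ∈ (0,1]` and every symmetric convex set `K ⊆ ℝⁿ` with `0 < vol(K) ≤ 1 - ε`, the
expected squared norm of a draw from `N(0,I_n)|K` is at most `n - c·ε`. -/
theorem truncated_gaussian_expected_sq_norm_le :
    ∃ c : ℝ, 0 < c ∧
      ∀ (n : ℕ) (ε : ℝ) (K : Set (EuclideanSpace ℝ (Fin n))),
        0 < ε → ε ≤ 1 → Convex ℝ K → (∀ x ∈ K, -x ∈ K) → MeasurableSet K →
        0 < (stdGaussian n K).toReal → (stdGaussian n K).toReal ≤ 1 - ε →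
        ∫ x, ‖x‖ ^ 2 ∂(truncGaussian n K) ≤ n - c * ε := by
  refine ⟨1 / 4, by norm_num, ?_⟩
  intro n ε K h0 h1 hc hs hm hpos hle
  have hfr : _root_.stdGaussian n (frontier K) = 0 := stdG_ac n (hc.addHaar_frontier volume)
  have hae : closure K =ᵐ[_root_.stdGaussian n] K := by
    have : (closure K \ K : Set _) ⊆ frontier K := fun x hx =>
      ⟨hx.1, fun hi => hx.2 (interior_subset hi)⟩
    refine Filter.EventuallyLE.antisymm ?_ subset_closure.eventuallyLE
    rw [ae_le_set]
    exact measure_mono_null this hfr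
  have hvv : (_root_.stdGaussian n).real (closure K) = (_root_.stdGaussian n).real K :=
    measureReal_congr hae
  have hne : K.Nonempty := by
    rw [Set.nonempty_iff_ne_empty]
    rintro rfl
    simp at hpos
  have hsc : ∀ x ∈ closure K, -x ∈ closure K := fun x hx =>
    map_mem_closure continuous_neg hx hs
  have hv' : (_root_.stdGaussian n).real K ≤ 1 - ε := hle
  have hp' : 0 < (_root_.stdGaussian n).real K := hpos
  have key := closed_case n (closure K) hc.closure hsc isClosed_closure hne.closure ε h0 h1
    (hvv.trans_le hv')
  rw [hvv, setIntegral_congr_set hae] at key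
  unfold truncGaussian
  rw [integral_smul_measure, ENNReal.toReal_inv, smul_eq_mul]
  show ((_root_.stdGaussian n).real K)⁻¹ * _ ≤ _
  rw [inv_mul_le_iff₀ hp', mul_comm]
  exact key
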